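/- Let R₁, R₂, R₃ ∈ ℂ, not all zero, and let M₁ be the 4×4 complex matrix equal to the identity except that its first row is (1, 2πi R₁, 2πi R₂, 2πi R₃). Then the centralizer of M₁ in the space of 4×4 complex matrices, i.e. the ℂ-subspace { B : B·M₁ = M₁·B }, has dimension 10. -/

import Mathlib

open Complex Matrix Real

/-- The monodromy matrix at `z = 1`: the identity matrix except that its first
row is `(1, 2πi R₁, 2πi R₂, 2πi R₃)`. -/
noncomputable def monodromyM1 (R₁ R₂ R₃ : ℂ) : Matrix (Fin 4) (Fin 4) ℂ :=
  fun i j =>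
    if i = j then 1
    else if i = 0 then (2 * π * Complex.I) * (![0, R₁, R₂, R₃] j)
    else 0

/-- The centralizer of a matrix `M`, as a `ℂ`-subspace of the `4×4` complex
matrices. -/
noncomputable def centralizerSubspace (M : Matrix (Fin 4) (Fin 4) ℂ) :
    Submodule ℂ (Matrix (Fin 4) (Fin 4) ℂ) where
  carrier := {B | B * M = M * B}
  add_mem' := by
    intro B C hB hC
    simp only [Set.mem_setOf_eq] at *
    rw [add_mul, mul_add, hB, hC]
  zero_mem' := by simp
  smul_mem' := by
    intro c B hB
    simp only [Set.mem_setOf_eq] at *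
    rw [smul_mul_assoc, mul_smul_comm, hB]


/-- The six independent linear conditions that cut out the centralizer. -/
noncomputable def centralizerConditions (a b c : ℂ) :
    Matrix (Fin 4) (Fin 4) ℂ →ₗ[ℂ] (Fin 6 → ℂ) where
  toFun B := ![B 1 0, B 2 0, B 3 0,
    a * B 1 1 + b * B 2 1 + c * B 3 1 - B 0 0 * a,
    a * B 1 2 + b * B 2 2 + c * B 3 2 - B 0 0 * b,
    a * B 1 3 + b * B 2 3 + c * B 3 3 - B 0 0 * c]
  map_add' B C := by
    ext i
    fin_cases i <;> simp <;> ring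
  map_smul' t B := by
    ext i
    fin_cases i <;> simp <;> ring

theorem exists_dual (a b c : ℂ) (h : ¬(a = 0 ∧ b = 0 ∧ c = 0)) :
    ∃ x y z : ℂ, a * x + b * y + c * z = 1 := by
  by_cases ha : a = 0
  · by_cases hb : b = 0
    · have hc : c ≠ 0 := fun hc => h ⟨ha, hb, hc⟩
      exact ⟨0, 0, c⁻¹, by simp [hc]⟩
    · exact ⟨0, b⁻¹, 0, by simp [hb]⟩
  · exact ⟨a⁻¹, 0, 0, by simp [ha]⟩

theorem centralizerConditions_surjective (a b c : ℂ) (h : ¬(a = 0 ∧ b = 0 ∧ c = 0)) :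
    Function.Surjective (centralizerConditions a b c) := by
  obtain ⟨x, y, z, hs⟩ := exists_dual a b c h
  intro v
  refine ⟨!![0, 0, 0, 0; v 0, x * v 3, x * v 4, x * v 5;
    v 1, y * v 3, y * v 4, y * v 5; v 2, z * v 3, z * v 4, z * v 5], ?_⟩
  ext i
  fin_cases i <;> simp [centralizerConditions]
  · linear_combination v 3 * hs
  · linear_combination v 4 * hs
  · linear_combination v 5 * hs

theorem centralizer_eq_ker (a b c : ℂ) (h : ¬(a = 0 ∧ b = 0 ∧ c = 0)) :
    centralizerSubspace (monodromyM1 a b c) = LinearMap.ker (centralizerConditions a b c) := by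
  obtain ⟨x, y, z, hs⟩ := exists_dual a b c h
  have hp : (2 * (π : ℂ) * Complex.I) ≠ 0 := Complex.two_pi_I_ne_zero
  ext B
  rw [LinearMap.mem_ker]
  change B * monodromyM1 a b c = monodromyM1 a b c * B ↔ _
  have hM : monodromyM1 a b c = !![1, 2 * (π : ℂ) * Complex.I * a, 2 * (π : ℂ) * Complex.I * b,
      2 * (π : ℂ) * Complex.I * c; 0, 1, 0, 0; 0, 0, 1, 0; 0, 0, 0, 1] := by
    ext i j
    fin_cases i <;> fin_cases j <;> simp [monodromyM1]
  rw [hM]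
  clear hM
  generalize 2 * (π : ℂ) * Complex.I = p at hp
  constructor
  · intro hB
    have e : ∀ i j, _ := fun i j => congrFun (congrFun hB i) j
    simp only [Matrix.mul_apply, Fin.sum_univ_four] at e
    have key : ∀ t : ℂ, t * (p * a) = 0 → t * (p * b) = 0 → t * (p * c) = 0 → t = 0 := by
      intro t h1 h2 h3
      have : p * t = 0 := by linear_combination x * h1 + y * h2 + z * h3 - p * t * hs
      exact (mul_eq_zero.mp this).resolve_left hp
    have z1 : B 1 0 = 0 := by
      have h1 := e 1 1
      have h2 := e 1 2
      have h3 := e 1 3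
      simp at h1 h2 h3
      exact key _ (by simpa using h1) (by simpa using h2) (by simpa using h3)
    have z2 : B 2 0 = 0 := by
      have h1 := e 2 1
      have h2 := e 2 2
      have h3 := e 2 3
      simp at h1 h2 h3
      exact key _ (by simpa using h1) (by simpa using h2) (by simpa using h3)
    have z3 : B 3 0 = 0 := by
      have h1 := e 3 1
      have h2 := e 3 2
      have h3 := e 3 3
      simp at h1 h2 h3
      exact key _ (by simpa using h1) (by simpa using h2) (by simpa using h3)
    have h1 := e 0 1
    have h2 := e 0 2
    have h3 := e 0 3
    simp at h1 h2 h3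
    ext i
    fin_cases i <;> simp [centralizerConditions, z1, z2, z3]
    · apply mul_left_cancel₀ hp
      linear_combination -h1
    · apply mul_left_cancel₀ hp
      linear_combination -h2
    · apply mul_left_cancel₀ hp
      linear_combination -h3
  · intro hB
    have z1 : B 1 0 = 0 := congrFun hB 0
    have z2 : B 2 0 = 0 := congrFun hB 1
    have z3 : B 3 0 = 0 := congrFun hB 2
    have h1 : a * B 1 1 + b * B 2 1 + c * B 3 1 - B 0 0 * a = 0 := congrFun hB 3
    have h2 : a * B 1 2 + b * B 2 2 + c * B 3 2 - B 0 0 * b = 0 := congrFun hB 4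
    have h3 : a * B 1 3 + b * B 2 3 + c * B 3 3 - B 0 0 * c = 0 := congrFun hB 5
    ext i j
    rw [Matrix.mul_apply, Matrix.mul_apply, Fin.sum_univ_four, Fin.sum_univ_four]
    fin_cases i <;> fin_cases j <;> simp [z1, z2, z3]
    · linear_combination -p * h1
    · linear_combination -p * h2
    · linear_combination -p * h3

/-- The centralizer of the monodromy matrix `M₁` in the space of `4×4` complex
matrices has dimension `10`. -/
theorem centralizer_dim_ten (R₁ R₂ R₃ : ℂ) (h : ¬(R₁ = 0 ∧ R₂ = 0 ∧ R₃ = 0)) :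
    Module.finrank ℂ (centralizerSubspace (monodromyM1 R₁ R₂ R₃)) = 10 := by
  rw [centralizer_eq_ker R₁ R₂ R₃ h]
  have h1 := LinearMap.finrank_range_add_finrank_ker (centralizerConditions R₁ R₂ R₃)
  rw [LinearMap.range_eq_top.mpr (centralizerConditions_surjective R₁ R₂ R₃ h), finrank_top,
    Module.finrank_matrix] at h1
  simp at h1
  omega
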